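/- arXiv:1302.5808 — 2 statements merged into one kernel-verified Lean document; each statement's English description precedes it below -/
import Mathlib

section
/- Let k ≥ 2. In the braid group B₅ one has the identity δ₃^{3k+1} σ₄^{2k+2} σ₃ σ₄^{2k−1} = (Δ₃σ₄)^{2k} · (δ₃σ₄σ₃σ₄) · (σ₃σ₄) · σ₄^{2k−3}. Moreover, each of the factors Δ₃σ₄ (appearing 2k times), δ₃σ₄σ₃σ₄, σ₃σ₄, and σ₄ (appearing 2k−3 times) is a simple braid distinct from 1 and from Δ, and every pair of consecutive factors in this product is left-weighted; that is, this factorization is the left normal form of T_k. -/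
/-- Defining relations of the braid group on 5 strands, as elements of the
free group on four generators (generator `i` corresponds to `σ_{i+1}`). -/
def braidRels : Set (FreeGroup (Fin 4)) :=
  { r | (∃ i : Fin 3, r = FreeGroup.of i.castSucc * FreeGroup.of i.succ * FreeGroup.of i.castSucc *
          (FreeGroup.of i.succ * FreeGroup.of i.castSucc * FreeGroup.of i.succ)⁻¹) ∨
        (∃ i j : Fin 4, 2 ≤ |(i : ℤ) - (j : ℤ)| ∧
          r = FreeGroup.of i * FreeGroup.of j * (FreeGroup.of j * FreeGroup.of i)⁻¹) }

/-- The Artin braid group on 5 strands. -/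
abbrev B5 : Type := PresentedGroup braidRels

/-- The Artin generators (index `i` corresponds to `σ_{i+1}`). -/
def gen (i : Fin 4) : B5 := PresentedGroup.of i

def s1 : B5 := gen 0
def s2 : B5 := gen 1
def s3 : B5 := gen 2
def s4 : B5 := gen 3

/-- A braid is positive if it lies in the submonoid generated by `σ₁,…,σ₄`. -/
def IsPos (x : B5) : Prop := x ∈ Submonoid.closure (Set.range gen)

/-- Prefix order: `Pre x y` means `x ≼ y`, i.e. `x⁻¹ y` is positive. -/
def Pre (x y : B5) : Prop := IsPos (x⁻¹ * y)

/-- The half twist `Δ = σ₁σ₂σ₃σ₄σ₁σ₂σ₃σ₁σ₂σ₁`. -/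
def Δ : B5 := s1*s2*s3*s4*s1*s2*s3*s1*s2*s1

def δ3 : B5 := s2*s1
def Δ3 : B5 := s2*s1*s2
def δt3 : B5 := s1*s2

/-- A braid `s` is simple if `1 ≼ s ≼ Δ`. -/
def IsSimple (s : B5) : Prop := IsPos s ∧ Pre s Δ

/-- Two simple braids `s, t` are left-weighted if no generator `σᵢ` is such that
`s σᵢ` and `σᵢ⁻¹ t` are both simple. -/
def LeftWeighted (s t : B5) : Prop :=
  ¬ ∃ i : Fin 4, IsSimple (s * gen i) ∧ IsSimple ((gen i)⁻¹ * t)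

/-- The canonical length of `z`: the minimum of `q - p` over `p ≤ q` with
`Δ^p ≼ z` and `z ≼ Δ^q`. -/
noncomputable def canLen (z : B5) : ℕ :=
  sInf { n : ℕ | ∃ p q : ℤ, p ≤ q ∧ q - p = (n : ℤ) ∧ Pre (Δ ^ p) z ∧ Pre z (Δ ^ q) }

/-- `y` belongs to the super summit set of `x`:
`y` is conjugate to `x` and has minimal canonical length among conjugates of `x`. -/
def InSSS (x y : B5) : Prop :=
  IsConj x y ∧ ∀ z : B5, IsConj x z → canLen y ≤ canLen z

/-- The braid `T_k = δ₃^{3k+1} σ₄^{2k+2} σ₃ σ₄^{2k-1}`. -/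
def T (k : ℕ) : B5 := δ3 ^ (3*k+1) * s4 ^ (2*k+2) * s3 * s4 ^ (2*k-1)

/-- The braid `T'_k`, a rigid conjugate of `T_k`. -/
def T' (k : ℕ) : B5 :=
  (s1*s3)^(2*k-2) * (s3*s4*Δ3) * (Δ3*s4) * ((δ3*s4)*(δt3*s4))^(k-1) * (δ3*s4*s3*s4)

lemma gen_braid (i : Fin 3) :
    gen i.castSucc * gen i.succ * gen i.castSucc = gen i.succ * gen i.castSucc * gen i.succ := by
  have h := PresentedGroup.one_of_mem (rels := braidRels) (Or.inl ⟨i, rfl⟩)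
  rw [map_mul, map_inv, mul_inv_eq_one] at h
  simp only [map_mul] at h
  exact h

lemma gen_comm (i j : Fin 4) (h : 2 ≤ |(i : ℤ) - (j : ℤ)|) :
    gen i * gen j = gen j * gen i := by
  have h := PresentedGroup.one_of_mem (rels := braidRels) (Or.inr ⟨i, j, h, rfl⟩)
  rw [map_mul, map_inv, mul_inv_eq_one] at h
  simp only [map_mul] at h
  exact h

lemma s1_s2_s1 : s1 * s2 * s1 = s2 * s1 * s2 := gen_braid 0
lemma s2_s3_s2 : s2 * s3 * s2 = s3 * s2 * s3 := gen_braid 1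
lemma s3_s4_s3 : s3 * s4 * s3 = s4 * s3 * s4 := gen_braid 2
lemma s3_s1 : Commute s3 s1 := gen_comm 2 0 (by decide)
lemma s4_s1 : Commute s4 s1 := gen_comm 3 0 (by decide)
lemma s4_s2 : Commute s4 s2 := gen_comm 3 1 (by decide)

lemma isPos_gen (i : Fin 4) : IsPos (gen i) := Submonoid.subset_closure ⟨i, rfl⟩

lemma isSimple_of_mul_eq {x y : B5} (hx : IsPos x) (hy : IsPos y) (h : Δ = x * y) :
    IsSimple x :=
  ⟨hx, by rw [Pre, h, inv_mul_cancel_left]; exact hy⟩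

/-- The adjacent transposition `(i, i + 1)`. -/
def adj (i : Fin 4) : Equiv.Perm (Fin 5) := Equiv.swap i.castSucc i.succ

/-- The permutation induced by a braid. -/
def permHom : B5 →* Equiv.Perm (Fin 5) :=
  PresentedGroup.toGroup (f := adj) (by
    rintro r (⟨i, rfl⟩ | ⟨i, j, h, rfl⟩)
    · simp only [map_mul, map_inv, FreeGroup.lift_apply_of]
      revert i
      decide
    · simp only [map_mul, map_inv, FreeGroup.lift_apply_of]
      revert i j
      decide)

/-- The exponent sum of a braid. -/
def lenHom : B5 →* Multiplicative ℤ :=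
  PresentedGroup.toGroup (f := fun _ => Multiplicative.ofAdd 1) (by
    rintro r (⟨i, rfl⟩ | ⟨i, j, h, rfl⟩) <;> simp)

@[simp] lemma permHom_gen (i : Fin 4) : permHom (gen i) = adj i := PresentedGroup.toGroup.of _

@[simp] lemma lenHom_gen (i : Fin 4) : lenHom (gen i) = Multiplicative.ofAdd 1 :=
  PresentedGroup.toGroup.of _

/-- The set of inversions of a permutation. -/
def invSet (p : Equiv.Perm (Fin 5)) : Finset (Fin 5 × Fin 5) :=
  Finset.univ.filter fun x => x.1 < x.2 ∧ p x.2 < p x.1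

lemma mem_invSet {p : Equiv.Perm (Fin 5)} {x : Fin 5 × Fin 5} :
    x ∈ invSet p ↔ x.1 < x.2 ∧ p x.2 < p x.1 := by
  simp [invSet]

lemma card_invSet_mul_le (p q : Equiv.Perm (Fin 5)) :
    (invSet (p * q)).card ≤ (invSet p).card + (invSet q).card := by
  have hsub : invSet (p * q) ⊆
      (invSet p).map (Equiv.prodCongr q q).symm.toEmbedding ∪ invSet q := by
    rintro ⟨i, j⟩ h
    simp only [mem_invSet, Finset.mem_union, Finset.mem_map_equiv, Equiv.symm_symm,
      Equiv.prodCongr_apply, Prod.map_apply, Equiv.Perm.mul_apply] at h ⊢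
    rcases lt_trichotomy (q i) (q j) with hij | hij | hij
    · exact Or.inl ⟨hij, h.2⟩
    · exact absurd (q.injective hij) h.1.ne
    · exact Or.inr ⟨h.1, hij⟩
  calc (invSet (p * q)).card ≤ _ := Finset.card_le_card hsub
    _ ≤ _ := Finset.card_union_le _ _
    _ = _ := by rw [Finset.card_map]

lemma card_invSet_le_of_isPos {x : B5} (hx : IsPos x) :
    ((invSet (permHom x)).card : ℤ) ≤ (lenHom x).toAdd := by
  induction hx using Submonoid.closure_induction with
  | mem x hx =>
    obtain ⟨i, rfl⟩ := hx
    rw [permHom_gen, lenHom_gen]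
    revert i
    decide
  | one => simp [invSet]; grind
  | mul x y _ _ hx hy =>
    have h := card_invSet_mul_le (permHom x) (permHom y)
    rw [map_mul, map_mul, toAdd_mul]
    lia

lemma len_Δ : (lenHom Δ).toAdd = 10 := by simp [Δ, s1, s2, s3, s4]

lemma IsSimple.card_invSet_eq {x : B5} (hx : IsSimple x) :
    ((invSet (permHom x)).card : ℤ) = (lenHom x).toAdd := by
  have h₁ := card_invSet_le_of_isPos hx.1
  have h₂ := card_invSet_le_of_isPos hx.2
  have h₃ := card_invSet_mul_le (permHom x) (permHom (x⁻¹ * Δ))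
  rw [← map_mul, mul_inv_cancel_left] at h₃
  have hΔ : (invSet (permHom Δ)).card = 10 := by
    simp only [Δ, s1, s2, s3, s4, map_mul, permHom_gen]
    decide
  rw [map_mul lenHom, map_inv lenHom, toAdd_mul, toAdd_inv, len_Δ] at h₂
  lia

lemma leftWeighted_of_perm {s t : B5} {p q : Equiv.Perm (Fin 5)} {m n : ℤ}
    (hp : permHom s = p) (hm : (lenHom s).toAdd = m)
    (hq : permHom t = q) (hn : (lenHom t).toAdd = n)
    (h : ∀ i, ¬ (((invSet (p * adj i)).card : ℤ) = m + 1 ∧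
      ((invSet ((adj i)⁻¹ * q)).card : ℤ) = -1 + n)) : LeftWeighted s t := by
  rintro ⟨i, h₁, h₂⟩
  refine h i ⟨?_, ?_⟩
  · simpa [hp, hm] using h₁.card_invSet_eq
  · simpa [hq, hn] using h₂.card_invSet_eq

lemma perm_Δ3_s4 : permHom (Δ3 * s4) = adj 1 * adj 0 * adj 1 * adj 3 := by
  simp [Δ3, s1, s2, s4]

lemma perm_δ3_s4_s3_s4 :
    permHom (δ3 * s4 * s3 * s4) = adj 1 * adj 0 * adj 3 * adj 2 * adj 3 := by
  simp [δ3, s1, s2, s3, s4, mul_assoc]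

lemma perm_s3_s4 : permHom (s3 * s4) = adj 2 * adj 3 := by simp [s3, s4]

lemma perm_s4 : permHom s4 = adj 3 := permHom_gen 3

lemma len_Δ3_s4 : (lenHom (Δ3 * s4)).toAdd = 4 := by simp [Δ3, s1, s2, s4]

lemma len_δ3_s4_s3_s4 : (lenHom (δ3 * s4 * s3 * s4)).toAdd = 5 := by
  simp [δ3, s1, s2, s3, s4]

lemma len_s3_s4 : (lenHom (s3 * s4)).toAdd = 2 := by simp [s3, s4]

lemma len_s4 : (lenHom s4).toAdd = 1 := by simp [s4]

lemma ne_one_and_ne_Δ {x : B5} {n : ℤ} (hx : (lenHom x).toAdd = n) (h₀ : n ≠ 0)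
    (h₁ : n ≠ 10) : x ≠ 1 ∧ x ≠ Δ := by
  subst hx
  refine ⟨?_, ?_⟩ <;> rintro rfl
  · exact h₀ (by simp)
  · exact h₁ len_Δ

lemma δ3_pow_three : δ3 ^ 3 = Δ3 ^ 2 := by
  have h := s1_s2_s1
  simp only [δ3, Δ3, pow_succ, pow_zero, one_mul, mul_assoc] at h ⊢
  rw [h]

lemma commute_Δ3_s4 : Commute Δ3 s4 :=
  ((s4_s2.mul_right s4_s1).mul_right s4_s2).symm

lemma T_eq (k : ℕ) (hk : 2 ≤ k) :
    T k = (Δ3 * s4) ^ (2 * k) * ((δ3 * s4 * s3 * s4) * (s3 * s4)) * s4 ^ (2 * k - 3) := by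
  obtain ⟨m, hm⟩ : ∃ m, 2 * k = m + 3 := ⟨2 * k - 3, by lia⟩
  have hδ : Commute δ3 s4 := (s4_s2.mul_right s4_s1).symm
  have h := s3_s4_s3
  have hpow : δ3 ^ (3 * k + 1) = Δ3 ^ (2 * k) * δ3 := by
    rw [pow_succ, pow_mul, δ3_pow_three, ← pow_mul]
  have e₁ : 2 * k - 1 = m + 2 := by lia
  have e₂ : 2 * k - 3 = m := by lia
  rw [T, hpow, commute_Δ3_s4.mul_pow, e₁, e₂, pow_add s4 (2 * k) 2, add_comm m 2, pow_add s4 2 m]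
  calc Δ3 ^ (2 * k) * δ3 * (s4 ^ (2 * k) * s4 ^ 2) * s3 * (s4 ^ 2 * s4 ^ m)
      = Δ3 ^ (2 * k) * (δ3 * s4 ^ (2 * k)) * s4 * (s4 * s3 * s4) * s4 * s4 ^ m := by
        simp only [pow_two, mul_assoc]
    _ = Δ3 ^ (2 * k) * (s4 ^ (2 * k) * δ3) * s4 * (s3 * s4 * s3) * s4 * s4 ^ m := by
        rw [(hδ.pow_right _).eq, h]
    _ = _ := by simp only [mul_assoc]

lemma isSimple_Δ3_s4 : IsSimple (Δ3 * s4) := by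
  have h : Δ = (Δ3 * s4) * (s3 * s4 * s2 * s3 * s1 * s2) := by
    calc Δ = s1 * s2 * s3 * s4 * s1 * s2 * s3 * s1 * s2 * s1 := rfl
      _ = s1 * s2 * s3 * s1 * s4 * s2 * s3 * s1 * s2 * s1 := by
        simpa only [mul_assoc] using
          congr_arg (fun z => s1 * s2 * s3 * z * (s2 * s3 * s1 * s2 * s1)) s4_s1.eq
      _ = s1 * s2 * s1 * s3 * s4 * s2 * s3 * s1 * s2 * s1 := by
        simpa only [mul_assoc] using
          congr_arg (fun z => s1 * s2 * z * (s4 * s2 * s3 * s1 * s2 * s1)) s3_s1.eq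
      _ = s2 * s1 * s2 * s3 * s4 * s2 * s3 * s1 * s2 * s1 := by
        simpa only [mul_assoc] using
          congr_arg (fun z => z * (s3 * s4 * s2 * s3 * s1 * s2 * s1)) s1_s2_s1
      _ = s2 * s1 * s2 * s3 * s4 * s2 * s3 * s2 * s1 * s2 := by
        simpa only [mul_assoc] using
          congr_arg (fun z => s2 * s1 * s2 * s3 * s4 * s2 * s3 * z) s1_s2_s1
      _ = s2 * s1 * s2 * s3 * s4 * s3 * s2 * s3 * s1 * s2 := by
        simpa only [mul_assoc] using
          congr_arg (fun z => s2 * s1 * s2 * s3 * s4 * z * (s1 * s2)) s2_s3_s2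
      _ = s2 * s1 * s2 * s4 * s3 * s4 * s2 * s3 * s1 * s2 := by
        simpa only [mul_assoc] using
          congr_arg (fun z => s2 * s1 * s2 * z * (s2 * s3 * s1 * s2)) s3_s4_s3
      _ = _ := by simp only [Δ3, mul_assoc]
  refine isSimple_of_mul_eq ?_ ?_ h <;> simp only [Δ3, IsPos] <;>
    repeat first
      | exact isPos_gen _
      | apply mul_mem

lemma isSimple_δ3_s4_s3_s4 : IsSimple (δ3 * s4 * s3 * s4) := by
  have h : Δ = (δ3 * s4 * s3 * s4) * (s2 * s3 * s4 * s1 * s2) := by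
    calc Δ = s1 * s2 * s3 * s4 * s1 * s2 * s3 * s1 * s2 * s1 := rfl
      _ = s1 * s2 * s3 * s1 * s4 * s2 * s3 * s1 * s2 * s1 := by
        simpa only [mul_assoc] using
          congr_arg (fun z => s1 * s2 * s3 * z * (s2 * s3 * s1 * s2 * s1)) s4_s1.eq
      _ = s1 * s2 * s1 * s3 * s4 * s2 * s3 * s1 * s2 * s1 := by
        simpa only [mul_assoc] using
          congr_arg (fun z => s1 * s2 * z * (s4 * s2 * s3 * s1 * s2 * s1)) s3_s1.eq
      _ = s2 * s1 * s2 * s3 * s4 * s2 * s3 * s1 * s2 * s1 := by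
        simpa only [mul_assoc] using
          congr_arg (fun z => z * (s3 * s4 * s2 * s3 * s1 * s2 * s1)) s1_s2_s1
      _ = s2 * s1 * s2 * s3 * s2 * s4 * s3 * s1 * s2 * s1 := by
        simpa only [mul_assoc] using
          congr_arg (fun z => s2 * s1 * s2 * s3 * z * (s3 * s1 * s2 * s1)) s4_s2.eq
      _ = s2 * s1 * s3 * s2 * s3 * s4 * s3 * s1 * s2 * s1 := by
        simpa only [mul_assoc] using
          congr_arg (fun z => s2 * s1 * z * (s4 * s3 * s1 * s2 * s1)) s2_s3_s2
      _ = s2 * s1 * s3 * s2 * s4 * s3 * s4 * s1 * s2 * s1 := by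
        simpa only [mul_assoc] using
          congr_arg (fun z => s2 * s1 * s3 * s2 * z * (s1 * s2 * s1)) s3_s4_s3
      _ = s2 * s1 * s3 * s4 * s2 * s3 * s4 * s1 * s2 * s1 := by
        simpa only [mul_assoc] using
          congr_arg (fun z => s2 * s1 * s3 * z * (s3 * s4 * s1 * s2 * s1)) s4_s2.symm.eq
      _ = s2 * s1 * s3 * s4 * s2 * s3 * s4 * s2 * s1 * s2 := by
        simpa only [mul_assoc] using
          congr_arg (fun z => s2 * s1 * s3 * s4 * s2 * s3 * s4 * z) s1_s2_s1
      _ = s2 * s1 * s3 * s4 * s2 * s3 * s2 * s4 * s1 * s2 := by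
        simpa only [mul_assoc] using
          congr_arg (fun z => s2 * s1 * s3 * s4 * s2 * s3 * z * (s1 * s2)) s4_s2.eq
      _ = s2 * s1 * s3 * s4 * s3 * s2 * s3 * s4 * s1 * s2 := by
        simpa only [mul_assoc] using
          congr_arg (fun z => s2 * s1 * s3 * s4 * z * (s4 * s1 * s2)) s2_s3_s2
      _ = s2 * s1 * s4 * s3 * s4 * s2 * s3 * s4 * s1 * s2 := by
        simpa only [mul_assoc] using
          congr_arg (fun z => s2 * s1 * z * (s2 * s3 * s4 * s1 * s2)) s3_s4_s3
      _ = _ := by simp only [δ3, mul_assoc]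
  refine isSimple_of_mul_eq ?_ ?_ h <;> simp only [δ3, IsPos] <;>
    repeat first
      | exact isPos_gen _
      | apply mul_mem

lemma isSimple_s3_s4 : IsSimple (s3 * s4) := by
  have h : Δ = (s3 * s4) * (s1 * s2 * s3 * s4 * s1 * s2 * s3 * s1) := by
    calc Δ = s1 * s2 * s3 * s4 * s1 * s2 * s3 * s1 * s2 * s1 := rfl
      _ = s1 * s2 * s3 * s4 * s1 * s2 * s1 * s3 * s2 * s1 := by
        simpa only [mul_assoc] using
          congr_arg (fun z => s1 * s2 * s3 * s4 * s1 * s2 * z * (s2 * s1)) s3_s1.eq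
      _ = s1 * s2 * s3 * s4 * s2 * s1 * s2 * s3 * s2 * s1 := by
        simpa only [mul_assoc] using
          congr_arg (fun z => s1 * s2 * s3 * s4 * z * (s3 * s2 * s1)) s1_s2_s1
      _ = s1 * s2 * s3 * s2 * s4 * s1 * s2 * s3 * s2 * s1 := by
        simpa only [mul_assoc] using
          congr_arg (fun z => s1 * s2 * s3 * z * (s1 * s2 * s3 * s2 * s1)) s4_s2.eq
      _ = s1 * s3 * s2 * s3 * s4 * s1 * s2 * s3 * s2 * s1 := by
        simpa only [mul_assoc] using
          congr_arg (fun z => s1 * z * (s4 * s1 * s2 * s3 * s2 * s1)) s2_s3_s2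
      _ = s3 * s1 * s2 * s3 * s4 * s1 * s2 * s3 * s2 * s1 := by
        simpa only [mul_assoc] using
          congr_arg (fun z => z * (s2 * s3 * s4 * s1 * s2 * s3 * s2 * s1)) s3_s1.symm.eq
      _ = s3 * s1 * s2 * s3 * s4 * s1 * s3 * s2 * s3 * s1 := by
        simpa only [mul_assoc] using
          congr_arg (fun z => s3 * s1 * s2 * s3 * s4 * s1 * z * (s1)) s2_s3_s2
      _ = s3 * s1 * s2 * s3 * s4 * s3 * s1 * s2 * s3 * s1 := by
        simpa only [mul_assoc] using
          congr_arg (fun z => s3 * s1 * s2 * s3 * s4 * z * (s2 * s3 * s1)) s3_s1.symm.eq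
      _ = s3 * s1 * s2 * s4 * s3 * s4 * s1 * s2 * s3 * s1 := by
        simpa only [mul_assoc] using
          congr_arg (fun z => s3 * s1 * s2 * z * (s1 * s2 * s3 * s1)) s3_s4_s3
      _ = s3 * s1 * s4 * s2 * s3 * s4 * s1 * s2 * s3 * s1 := by
        simpa only [mul_assoc] using
          congr_arg (fun z => s3 * s1 * z * (s3 * s4 * s1 * s2 * s3 * s1)) s4_s2.symm.eq
      _ = s3 * s4 * s1 * s2 * s3 * s4 * s1 * s2 * s3 * s1 := by
        simpa only [mul_assoc] using
          congr_arg (fun z => s3 * z * (s2 * s3 * s4 * s1 * s2 * s3 * s1)) s4_s1.symm.eq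
      _ = _ := by simp only [mul_assoc]
  refine isSimple_of_mul_eq ?_ ?_ h <;> simp only [IsPos] <;>
    repeat first
      | exact isPos_gen _
      | apply mul_mem

lemma isSimple_s4 : IsSimple (s4) := by
  have h : Δ = (s4) * (s1 * s2 * s3 * s4 * s1 * s2 * s3 * s1 * s2) := by
    calc Δ = s1 * s2 * s3 * s4 * s1 * s2 * s3 * s1 * s2 * s1 := rfl
      _ = s1 * s2 * s3 * s4 * s1 * s2 * s3 * s2 * s1 * s2 := by
        simpa only [mul_assoc] using
          congr_arg (fun z => s1 * s2 * s3 * s4 * s1 * s2 * s3 * z) s1_s2_s1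
      _ = s1 * s2 * s3 * s4 * s1 * s3 * s2 * s3 * s1 * s2 := by
        simpa only [mul_assoc] using
          congr_arg (fun z => s1 * s2 * s3 * s4 * s1 * z * (s1 * s2)) s2_s3_s2
      _ = s1 * s2 * s3 * s4 * s3 * s1 * s2 * s3 * s1 * s2 := by
        simpa only [mul_assoc] using
          congr_arg (fun z => s1 * s2 * s3 * s4 * z * (s2 * s3 * s1 * s2)) s3_s1.symm.eq
      _ = s1 * s2 * s4 * s3 * s4 * s1 * s2 * s3 * s1 * s2 := by
        simpa only [mul_assoc] using
          congr_arg (fun z => s1 * s2 * z * (s1 * s2 * s3 * s1 * s2)) s3_s4_s3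
      _ = s1 * s4 * s2 * s3 * s4 * s1 * s2 * s3 * s1 * s2 := by
        simpa only [mul_assoc] using
          congr_arg (fun z => s1 * z * (s3 * s4 * s1 * s2 * s3 * s1 * s2)) s4_s2.symm.eq
      _ = s4 * s1 * s2 * s3 * s4 * s1 * s2 * s3 * s1 * s2 := by
        simpa only [mul_assoc] using
          congr_arg (fun z => z * (s2 * s3 * s4 * s1 * s2 * s3 * s1 * s2)) s4_s1.symm.eq
      _ = _ := by simp only [mul_assoc]
  refine isSimple_of_mul_eq ?_ ?_ h <;> simp only [IsPos] <;>
    repeat first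
      | exact isPos_gen _
      | apply mul_mem

/-- the left normal form of `T_k` is
`(Δ₃σ₄)^{2k} (δ₃σ₄σ₃σ₄) (σ₃σ₄) σ₄^{2k-3}`: the identity holds, each factor is a
simple braid distinct from `1` and `Δ`, and consecutive factors are left-weighted. -/
theorem Tk_left_normal_form (k : ℕ) (hk : 2 ≤ k) :
    T k = (List.replicate (2*k) (Δ3*s4) ++ [δ3*s4*s3*s4, s3*s4] ++
        List.replicate (2*k-3) s4).prod ∧
    (∀ f ∈ List.replicate (2*k) (Δ3*s4) ++ [δ3*s4*s3*s4, s3*s4] ++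
        List.replicate (2*k-3) s4, IsSimple f ∧ f ≠ 1 ∧ f ≠ Δ) ∧
    List.Chain' LeftWeighted (List.replicate (2*k) (Δ3*s4) ++ [δ3*s4*s3*s4, s3*s4] ++
        List.replicate (2*k-3) s4) := by
  have hs : ∀ f ∈ List.replicate (2*k) (Δ3*s4) ++ [δ3*s4*s3*s4, s3*s4] ++
      List.replicate (2*k-3) s4,
      f = Δ3 * s4 ∨ f = δ3 * s4 * s3 * s4 ∨ f = s3 * s4 ∨ f = s4 := by
    intro f hf
    simp only [List.mem_append, List.mem_replicate, List.mem_cons, List.not_mem_nil] at hf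
    tauto
  refine ⟨?_, fun f hf => ?_, ?_⟩
  · simpa [mul_assoc] using T_eq k hk
  · rcases hs f hf with rfl | rfl | rfl | rfl
    · exact ⟨isSimple_Δ3_s4, ne_one_and_ne_Δ len_Δ3_s4 (by decide) (by decide)⟩
    · exact ⟨isSimple_δ3_s4_s3_s4, ne_one_and_ne_Δ len_δ3_s4_s3_s4 (by decide) (by decide)⟩
    · exact ⟨isSimple_s3_s4, ne_one_and_ne_Δ len_s3_s4 (by decide) (by decide)⟩
    · exact ⟨isSimple_s4, ne_one_and_ne_Δ len_s4 (by decide) (by decide)⟩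
  · have h₁ : LeftWeighted (Δ3 * s4) (Δ3 * s4) :=
      leftWeighted_of_perm perm_Δ3_s4 len_Δ3_s4 perm_Δ3_s4 len_Δ3_s4 (by decide)
    have h₂ : LeftWeighted (Δ3 * s4) (δ3 * s4 * s3 * s4) :=
      leftWeighted_of_perm perm_Δ3_s4 len_Δ3_s4 perm_δ3_s4_s3_s4 len_δ3_s4_s3_s4 (by decide)
    have h₃ : LeftWeighted (δ3 * s4 * s3 * s4) (s3 * s4) :=
      leftWeighted_of_perm perm_δ3_s4_s3_s4 len_δ3_s4_s3_s4 perm_s3_s4 len_s3_s4 (by decide)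
    have h₄ : LeftWeighted (s3 * s4) s4 :=
      leftWeighted_of_perm perm_s3_s4 len_s3_s4 perm_s4 len_s4 (by decide)
    have h₅ : LeftWeighted s4 s4 :=
      leftWeighted_of_perm perm_s4 len_s4 perm_s4 len_s4 (by decide)
    refine List.isChain_append.2 ⟨List.isChain_append.2 ⟨?_, by simpa using h₃, ?_⟩, ?_, ?_⟩
    · exact List.isChain_replicate_of_rel _ h₁
    · intro x hx y hy
      obtain rfl := List.eq_of_mem_replicate (List.mem_of_mem_getLast? hx)
      obtain rfl : _ = y := by simpa using hy
      exact h₂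
    · exact List.isChain_replicate_of_rel _ h₅
    · intro x hx y hy
      obtain rfl := List.eq_of_mem_replicate (List.mem_of_mem_head? hy)
      obtain rfl : s3 * s4 = x := by simpa using hx
      exact h₄
end

section
/- Let k ≥ 2. The braid T'_k = (σ₁σ₃)^{2k−2}(σ₃σ₄Δ₃)(Δ₃σ₄)[(δ₃σ₄)(δ̃₃σ₄)]^{k−1}(δ₃σ₄σ₃σ₄) ∈ B₅ is not periodic: there are no nonzero integers m and l such that (T'_k)^m = Δ^l. The same holds for its conjugate T_k. -/
/-- The images of the Artin generators under the reduced Burau representation at `t = -1`. -/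
def burauMat : Fin 4 → Matrix (Fin 4) (Fin 4) ℤ :=
  ![!![1, 1, 0, 0; 0, 1, 0, 0; 0, 0, 1, 0; 0, 0, 0, 1],
    !![1, 0, 0, 0; -1, 1, 1, 0; 0, 0, 1, 0; 0, 0, 0, 1],
    !![1, 0, 0, 0; 0, 1, 0, 0; 0, -1, 1, 1; 0, 0, 0, 1],
    !![1, 0, 0, 0; 0, 1, 0, 0; 0, 0, 1, 0; 0, 0, -1, 1]]

/-- The generators act by transvections, so `2 - burauMat i` inverts `burauMat i`. -/
def burauUnit (i : Fin 4) : (Matrix (Fin 4) (Fin 4) ℤ)ˣ where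
  val := burauMat i
  inv := 2 - burauMat i
  val_inv := by fin_cases i <;> decide
  inv_val := by fin_cases i <;> decide

/-- The reduced Burau representation of `B5` at `t = -1`. -/
def burau : B5 →* (Matrix (Fin 4) (Fin 4) ℤ)ˣ :=
  PresentedGroup.toGroup (f := burauUnit) <| by
    rintro r (⟨i, rfl⟩ | ⟨i, j, hij, rfl⟩)
    · simp only [map_mul, map_inv, FreeGroup.lift_apply_of, mul_inv_eq_one]
      apply Units.ext
      fin_cases i <;> decide
    · simp only [map_mul, map_inv, FreeGroup.lift_apply_of, mul_inv_eq_one]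
      apply Units.ext
      revert i j
      decide

theorem burau_gen (i : Fin 4) : ((burau (gen i) : (Matrix (Fin 4) (Fin 4) ℤ)ˣ) :
    Matrix (Fin 4) (Fin 4) ℤ) = burauMat i := by
  simp [burau, gen, burauUnit]

theorem burau_Δ_pow_four : burau Δ ^ 4 = 1 := by
  apply Units.ext
  simp only [Δ, s1, s2, s3, s4, map_mul, Units.val_mul, Units.val_pow_eq_pow_val, burau_gen,
    Units.val_one]
  decide

/-- The trace of an integer matrix of finite order is bounded by its size. -/
theorem Matrix.abs_trace_le_of_isOfFinOrder {n : ℕ} {M : Matrix (Fin n) (Fin n) ℤ}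
    (hM : IsOfFinOrder M) : |M.trace| ≤ n := by
  obtain ⟨N, hN, hMN⟩ := isOfFinOrder_iff_pow_eq_one.mp hM
  set C : Matrix (Fin n) (Fin n) ℂ := M.map (Int.castRingHom ℂ) with hC
  have hCN : C ^ N = 1 := by
    rw [hC, ← RingHom.mapMatrix_apply, ← map_pow, hMN, map_one]
  have hroot : ∀ z ∈ C.charpoly.roots, ‖z‖ ≤ 1 := by
    intro z hz
    have hzs : z ∈ spectrum ℂ C :=
      Matrix.mem_spectrum_of_isRoot_charpoly (Polynomial.isRoot_of_mem_roots hz)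
    have hzN := spectrum.pow_mem_pow C N hzs
    rw [hCN] at hzN
    rcases isEmpty_or_nonempty (Fin n) with h | h
    · simp [spectrum.of_subsingleton] at hzN
    · rw [spectrum.one_eq, Set.mem_singleton_iff] at hzN
      exact (Complex.norm_eq_one_of_pow_eq_one hzN hN.ne').le
  have htr : (M.trace : ℂ) = C.charpoly.roots.sum := by
    rw [← Matrix.trace_eq_sum_roots_charpoly]
    simp [hC, Matrix.trace]
  have hnorm : ‖(M.trace : ℂ)‖ ≤ n := by
    rw [htr]
    calc ‖C.charpoly.roots.sum‖ ≤ (C.charpoly.roots.map fun z => ‖z‖).sum :=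
          norm_multiset_sum_le _
      _ ≤ Multiset.card (C.charpoly.roots.map fun z => ‖z‖) • (1 : ℝ) :=
          Multiset.sum_le_card_nsmul _ _ (by
            intro y hy
            obtain ⟨z, hz, rfl⟩ := Multiset.mem_map.mp hy
            exact hroot z hz)
      _ ≤ n := by
          rw [Multiset.card_map, nsmul_eq_mul, mul_one]
          have := C.charpoly.card_roots'
          rw [Matrix.charpoly_natDegree_eq_dim, Fintype.card_fin] at this
          exact_mod_cast this
  rw [Complex.norm_intCast] at hnorm
  exact_mod_cast hnorm

theorem not_periodic_of_trace {x : B5}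
    (hx : 4 < |((burau x : (Matrix (Fin 4) (Fin 4) ℤ)ˣ) : Matrix (Fin 4) (Fin 4) ℤ).trace|) :
    ¬ ∃ m l : ℤ, m ≠ 0 ∧ l ≠ 0 ∧ x ^ m = Δ ^ l := by
  rintro ⟨m, l, hm, -, h⟩
  have hfin : IsOfFinOrder (burau x) := by
    rw [isOfFinOrder_iff_zpow_eq_one]
    refine ⟨m * 4, by simpa using hm, ?_⟩
    rw [zpow_mul, ← map_zpow, h, map_zpow, ← zpow_mul, mul_comm, zpow_mul]
    have := burau_Δ_pow_four
    rw [← zpow_natCast] at this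
    rw [show burau Δ ^ (4 : ℤ) = 1 from this, one_zpow]
  have := Matrix.abs_trace_le_of_isOfFinOrder
    ((Units.coeHom (Matrix (Fin 4) (Fin 4) ℤ)).isOfFinOrder hfin)
  exact hx.not_ge this

theorem burauMat_three_pow (n : ℕ) :
    burauMat 3 ^ n = !![1, 0, 0, 0; 0, 1, 0, 0; 0, 0, 1, 0; 0, 0, -(n : ℤ), 1] := by
  induction n with
  | zero => decide
  | succ n ih =>
    rw [pow_succ, ih]
    ext i j
    fin_cases i <;> fin_cases j <;>
      simp [burauMat, Matrix.mul_apply, Fin.sum_univ_four]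
    ring

theorem burauMat_zero_mul_two_pow (n : ℕ) :
    (burauMat 0 * burauMat 2) ^ n =
      !![1, (n : ℤ), 0, 0; 0, 1, 0, 0; 0, -(n : ℤ), 1, (n : ℤ); 0, 0, 0, 1] := by
  induction n with
  | zero => decide
  | succ n ih =>
    rw [pow_succ, ih]
    ext i j
    fin_cases i <;> fin_cases j <;>
      simp [burauMat, Matrix.mul_apply, Fin.sum_univ_four] <;> ring

theorem burauMat_full_twist_pow (n : ℕ) :
    ((burauMat 1 * burauMat 0) ^ 3) ^ n =
      !![(-1) ^ n, 0, 1 - (-1) ^ n, 0; 0, (-1) ^ n, 0, 0; 0, 0, 1, 0; 0, 0, 0, 1] := by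
  have h : (burauMat 1 * burauMat 0) ^ 3 =
      !![-1, 0, 2, 0; 0, -1, 0, 0; 0, 0, 1, 0; 0, 0, 0, 1] := by decide
  rw [h]
  induction n with
  | zero => decide
  | succ n ih =>
    rw [pow_succ, ih]
    ext i j
    fin_cases i <;> fin_cases j <;>
      simp [Matrix.mul_apply, Fin.sum_univ_four] <;> ring

theorem burauMat_alternating_pow (n : ℕ) :
    ((burauMat 1 * burauMat 0) * burauMat 3 * ((burauMat 0 * burauMat 1) * burauMat 3)) ^ n =
      !![(-1) ^ n, -2 * (n : ℤ) * (-1) ^ n, 1 - (-1) ^ n, 0; 0, (-1) ^ n, 0, 0; 0, 0, 1, 0;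
        0, 0, -2 * (n : ℤ), 1] := by
  have h : (burauMat 1 * burauMat 0) * burauMat 3 * ((burauMat 0 * burauMat 1) * burauMat 3) =
      !![-1, 2, 2, 0; 0, -1, 0, 0; 0, 0, 1, 0; 0, 0, -2, 1] := by decide
  rw [h]
  induction n with
  | zero => decide
  | succ n ih =>
    rw [pow_succ, ih]
    ext i j
    fin_cases i <;> fin_cases j <;>
      simp [Matrix.mul_apply, Fin.sum_univ_four] <;> ring

theorem trace_burau_T (j : ℕ) :
    ((burau (T (j + 1)) : (Matrix (Fin 4) (Fin 4) ℤ)ˣ) : Matrix (Fin 4) (Fin 4) ℤ).trace =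
      -(4 * j + 3) := by
  have h : 2 * (j + 1) - 1 = 2 * j + 1 := by omega
  simp only [T, δ3, s1, s2, s3, s4, map_mul, map_pow, Units.val_mul, Units.val_pow_eq_pow_val,
    burau_gen, h, pow_succ (burauMat 1 * burauMat 0) (3 * (j + 1)),
    pow_mul (burauMat 1 * burauMat 0) 3, burauMat_full_twist_pow, burauMat_three_pow]
  simp [burauMat, Matrix.trace, Fin.sum_univ_four]
  ring

theorem trace_burau_T' (j : ℕ) :
    ((burau (T' (j + 1)) : (Matrix (Fin 4) (Fin 4) ℤ)ˣ) : Matrix (Fin 4) (Fin 4) ℤ).trace =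
      -(4 * j + 3) := by
  have h : 2 * (j + 1) - 2 = 2 * j := by omega
  simp only [T', δ3, Δ3, δt3, s1, s2, s3, s4, map_mul, map_pow, Units.val_mul,
    Units.val_pow_eq_pow_val, burau_gen, h, Nat.add_sub_cancel, burauMat_zero_mul_two_pow,
    burauMat_alternating_pow]
  simp [burauMat, Matrix.trace, Fin.sum_univ_four]
  ring

/-- `T'_k` is not periodic (no nonzero integers `m, l` with
`(T'_k)^m = Δ^l`), and the same holds for its conjugate `T_k`. -/
theorem T'k_not_periodic (k : ℕ) (hk : 2 ≤ k) :
    (¬ ∃ m l : ℤ, m ≠ 0 ∧ l ≠ 0 ∧ (T' k) ^ m = Δ ^ l) ∧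
    (¬ ∃ m l : ℤ, m ≠ 0 ∧ l ≠ 0 ∧ (T k) ^ m = Δ ^ l) := by
  obtain ⟨j, rfl⟩ : ∃ j, k = j + 1 := ⟨k - 1, by omega⟩
  constructor <;> apply not_periodic_of_trace
  · rw [trace_burau_T', abs_neg, abs_of_nonneg (by positivity)]
    omega
  · rw [trace_burau_T, abs_neg, abs_of_nonneg (by positivity)]
    omega
end
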